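/- Let Ω ⊂ ℝ² be a bounded open set satisfying the uniform interior cone condition with radius δ > 0 and aperture γ > 0. Let M > 0, q > 0 and α ∈ (0,1] with qα ≥ 2. Suppose J : Ω̄ → [0, ∞) is continuous, α-Hölder continuous (|J(x) − J(y)| ≤ M|x − y|^α for all x, y ∈ Ω̄), satisfies ∫_Ω J(x)^{−q} dx < ∞, and J(x) > 0 for every x ∈ ∂Ω. Then there exists η > 0 such that J(x) ≥ η for all x ∈ Ω̄. -/

import Mathlib

open MeasureTheory

/-- The open circular sector with vertex `y`, radius `δ` and angular set `I`. -/
def circularSector (y : EuclideanSpace ℝ (Fin 2)) (δ : ℝ) (I : Set ℝ) :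
    Set (EuclideanSpace ℝ (Fin 2)) :=
  {x | ∃ r ∈ Set.Ioo 0 δ, ∃ θ ∈ I,
    x = y + r • (EuclideanSpace.equiv (Fin 2) ℝ).symm ![Real.cos θ, Real.sin θ]}

/-- `Ω` satisfies the uniform interior cone condition with radius `δ` and aperture `γ`:
every `y ∈ Ω` is the vertex of an open circular sector of radius `δ` and angular measure `γ`
contained in `Ω`. -/
def UniformInteriorCone (Ω : Set (EuclideanSpace ℝ (Fin 2))) (δ γ : ℝ) : Prop :=
  ∀ y ∈ Ω, ∃ I : Set ℝ, MeasurableSet I ∧ I ⊆ Set.Ioo 0 (2 * Real.pi) ∧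
    volume I = ENNReal.ofReal γ ∧ circularSector y δ I ⊆ Ω

/-- the analytic content of the paper's Lemma 3.3: a nonnegative
`α`-Hölder continuous field `J` on `Ω̄` with `∫_Ω J^{-q} dx < ∞` (where `q·α ≥ 2`) and
`J > 0` on `∂Ω` is uniformly bounded away from zero on `Ω̄`. -/
theorem uniform_positive_lower_bound
    (Ω : Set (EuclideanSpace ℝ (Fin 2))) (hΩopen : IsOpen Ω)
    (hΩbdd : Bornology.IsBounded Ω)
    (δ γ M q α : ℝ) (hδ : 0 < δ) (hγ : 0 < γ)
    (hcone : UniformInteriorCone Ω δ γ)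
    (hM : 0 < M) (hq : 0 < q) (hα : α ∈ Set.Ioc (0 : ℝ) 1) (hqα : 2 ≤ q * α)
    (J : EuclideanSpace ℝ (Fin 2) → ℝ)
    (hJcont : ContinuousOn J (closure Ω))
    (hJnonneg : ∀ x ∈ closure Ω, 0 ≤ J x)
    (hHolder : ∀ x ∈ closure Ω, ∀ y ∈ closure Ω, |J x - J y| ≤ M * ‖x - y‖ ^ α)
    (hint : ∫⁻ x in Ω, ENNReal.ofReal (J x ^ (-q)) < ⊤)
    (hbdry : ∀ x ∈ frontier Ω, 0 < J x) :
    ∃ η > (0 : ℝ), ∀ x ∈ closure Ω, η ≤ J x := by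
  classical
  obtain ⟨hα0, hα1⟩ := hα
  have hK : IsCompact (closure Ω) := hΩbdd.isCompact_closure
  rcases (closure Ω).eq_empty_or_nonempty with hemp | hne
  · exact ⟨1, one_pos, by simp [hemp]⟩
  obtain ⟨x0, hx0, hmin⟩ := hK.exists_isMinOn hne hJcont
  rcases (hJnonneg x0 hx0).lt_or_eq with hpos | hzero
  · exact ⟨J x0, hpos, fun x hx => hmin hx⟩
  exfalso
  set Z : Set (EuclideanSpace ℝ (Fin 2)) := closure Ω ∩ J ⁻¹' {0} with hZ
  have hZclosed : IsClosed Z := hJcont.preimage_isClosed_of_isClosed isClosed_closure isClosed_singleton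
  have hZc : IsCompact Z := hK.of_isClosed_subset hZclosed Set.inter_subset_left
  have hZne : Z.Nonempty := ⟨x0, hx0, hzero.symm⟩
  have hZΩ : Z ⊆ Ω := by
    rintro x ⟨hx, hJx⟩
    by_contra hxn
    have : x ∈ frontier Ω := by rw [hΩopen.frontier_eq]; exact ⟨hx, hxn⟩
    exact (hbdry x this).ne' hJx
  obtain ⟨ε, hε, hthick⟩ := hZc.exists_thickening_subset_open hΩopen hZΩ
  obtain ⟨w, hw⟩ : ∃ w, w ∉ Ω := by
    by_contra! h
    have : Ω = Set.univ := Set.eq_univ_of_forall h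
    rw [this] at hΩbdd
    exact NormedSpace.unbounded_univ ℝ _ hΩbdd
  have hwd : ε ≤ Metric.infDist w Z := by
    by_contra! h
    obtain ⟨z, hz, hd⟩ := (Metric.infDist_lt_iff hZne).1 h
    exact hw (hthick (Metric.mem_thickening_iff.2 ⟨z, hz, hd⟩))
  -- key estimate
  have key : ∀ ρ : ℝ, 0 < ρ → 2 * ρ ≤ 1 → 2 * ρ < ε → ∃ x, Metric.ball x ρ ⊆ Ω ∧
      ENNReal.ofReal (M ^ (-q) * (Real.pi / 4)) ≤
        ∫⁻ y in Metric.ball x ρ, ENNReal.ofReal (J y ^ (-q)) := by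
    intro ρ hρ hρ1 hρε
    obtain ⟨x, hx⟩ : ∃ x, Metric.infDist x Z = ρ := by
      have := intermediate_value_univ x0 w (Metric.continuous_infDist_pt Z)
      apply this
      rw [Metric.infDist_zero_of_mem (show x0 ∈ Z from ⟨hx0, hzero.symm⟩)]
      exact ⟨hρ.le, by linarith⟩
    have hb : ∀ y ∈ Metric.ball x ρ, y ∈ Ω ∧ M ^ (-q) * (2 * ρ) ^ (-2 : ℝ) ≤ J y ^ (-q) := by
      intro y hy
      rw [Metric.mem_ball] at hy
      have h1 : Metric.infDist x Z ≤ Metric.infDist y Z + dist x y :=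
        Metric.infDist_le_infDist_add_dist
      have h2 : Metric.infDist y Z ≤ Metric.infDist x Z + dist y x :=
        Metric.infDist_le_infDist_add_dist
      rw [dist_comm x y] at h1
      obtain ⟨z, hz, hd⟩ := (Metric.infDist_lt_iff (r := 2 * ρ) hZne).1 (by linarith)
      have hyΩ : y ∈ Ω := hthick (Metric.mem_thickening_iff.2 ⟨z, hz, hd.trans hρε⟩)
      have hyc := subset_closure hyΩ
      have hyZ : y ∉ Z := by
        intro h
        rw [Metric.infDist_zero_of_mem h] at h1
        linarith
      have hJy : 0 < J y := lt_of_le_of_ne (hJnonneg y hyc) (fun h => hyZ ⟨hyc, h.symm⟩)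
      refine ⟨hyΩ, ?_⟩
      have hJle : J y ≤ M * (2 * ρ) ^ α := by
        have h := hHolder y hyc z hz.1
        rw [show J z = 0 from hz.2, sub_zero, abs_of_pos hJy, ← dist_eq_norm] at h
        refine h.trans ?_
        gcongr
      calc M ^ (-q) * (2 * ρ) ^ (-2 : ℝ) ≤ M ^ (-q) * (2 * ρ) ^ (α * -q) := by
            gcongr ?_ * ?_
            exact Real.rpow_le_rpow_of_exponent_ge (by linarith) hρ1 (by linarith)
        _ = (M * (2 * ρ) ^ α) ^ (-q) := by
            rw [Real.mul_rpow hM.le (by positivity), ← Real.rpow_mul (by positivity)]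
        _ ≤ J y ^ (-q) := Real.rpow_le_rpow_of_nonpos hJy hJle (by linarith)
    refine ⟨x, fun y hy => (hb y hy).1, ?_⟩
    calc ENNReal.ofReal (M ^ (-q) * (Real.pi / 4))
        = ENNReal.ofReal (M ^ (-q) * (2 * ρ) ^ (-2 : ℝ)) * volume (Metric.ball x ρ) := by
          rw [EuclideanSpace.volume_ball_fin_two, ← ENNReal.ofReal_pow hρ.le,
            ← ENNReal.ofReal_mul (by positivity),
            ← ENNReal.ofReal_mul (by positivity)]
          congr 1
          rw [Real.rpow_neg (x := 2 * ρ) (by positivity), Real.rpow_two]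
          field_simp
          norm_num
      _ = ∫⁻ y in Metric.ball x ρ, ENNReal.ofReal (M ^ (-q) * (2 * ρ) ^ (-2 : ℝ)) := by
          rw [setLIntegral_const]
      _ ≤ _ := setLIntegral_mono' measurableSet_ball
          (fun y hy => ENNReal.ofReal_le_ofReal (hb y hy).2)
  have hc : ENNReal.ofReal (M ^ (-q) * (Real.pi / 4)) ≠ 0 := by
    have : 0 < M ^ (-q) * (Real.pi / 4) := by positivity
    simpa using this
  obtain ⟨κ, hκ, hsmall⟩ := exists_pos_setLIntegral_lt_of_measure_lt hint.ne hc
  have htend : Filter.Tendsto (fun ρ : ℝ => ENNReal.ofReal (ρ ^ 2 * Real.pi))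
      (nhdsWithin 0 (Set.Ioi 0)) (nhds 0) := by
    have : Continuous (fun ρ : ℝ => ENNReal.ofReal (ρ ^ 2 * Real.pi)) :=
      ENNReal.continuous_ofReal.comp (by fun_prop)
    have h := this.tendsto 0
    simp only [ne_eq, OfNat.ofNat_ne_zero, not_false_eq_true, zero_pow, zero_mul,
      ENNReal.ofReal_zero] at h
    exact h.mono_left nhdsWithin_le_nhds
  have hev : ∀ᶠ ρ : ℝ in nhdsWithin 0 (Set.Ioi 0), ρ < min (1 / 2) (ε / 2) :=
    nhdsWithin_le_nhds (Iio_mem_nhds (by positivity))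
  obtain ⟨ρ, ⟨h1, h2⟩, h3⟩ :=
    ((htend.eventually (gt_mem_nhds hκ)).and hev |>.and self_mem_nhdsWithin).exists
  have hρ : 0 < ρ := h3
  obtain ⟨x, hsub, hle⟩ := key ρ hρ (by linarith [min_le_left (1 / 2) (ε / 2)])
    (by linarith [min_le_right (1 / 2) (ε / 2)])
  have hlt := hsmall (Metric.ball x ρ) (by
    refine lt_of_le_of_lt (Measure.restrict_apply_le _ _) ?_
    rw [EuclideanSpace.volume_ball_fin_two, ← ENNReal.ofReal_pow hρ.le,
      ← ENNReal.ofReal_mul (by positivity)]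
    exact h1)
  rw [Measure.restrict_restrict measurableSet_ball, Set.inter_eq_left.2 hsub] at hlt
  exact absurd hle (not_le.2 hlt)
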